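/- For every simple 3-regular acyclic finite directed multigraph D on 2n vertices with a unique source and a unique sink, there exists a simple 3-regular acyclic finite directed multigraph D' on 2n vertices with a unique source and a unique sink such that D' contains a directed Hamiltonian path and the number of source-to-sink paths of D' is at least the number of source-to-sink paths of D. -/

import Mathlib

/-- A finite directed multigraph with vertex set `Fin m` and edge set `Fin q`,
given by source and target maps. -/
structure Multigraph (m q : ℕ) where
  src : Fin q → Fin m
  tgt : Fin q → Fin m

namespace Multigraph

variable {m q : ℕ}

/-- `p` is a directed path from `u` to `v`: a nonempty list of edges whose first edge
starts at `u`, whose last edge ends at `v`, and where consecutive edges are composable. -/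
def IsPath (D : Multigraph m q) (u v : Fin m) (p : List (Fin q)) : Prop :=
  (∃ e rest, p = e :: rest ∧ D.src e = u) ∧
  (∃ e rest, p = rest ++ [e] ∧ D.tgt e = v) ∧
  p.Chain' (fun a b => D.tgt a = D.src b)

/-- The number of directed paths from `u` to `v` (paths counted as edge sequences). -/
noncomputable def pathCount (D : Multigraph m q) (u v : Fin m) : ℕ :=
  Nat.card {p : List (Fin q) // D.IsPath u v p}

/-- `D` is acyclic: no vertex has a directed path to itself. -/
def Acyclic (D : Multigraph m q) : Prop :=
  ∀ v : Fin m, ¬ ∃ p, D.IsPath v v p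

/-- In-degree of a vertex. -/
def indeg (D : Multigraph m q) (v : Fin m) : ℕ :=
  (Finset.univ.filter (fun e => D.tgt e = v)).card

/-- Out-degree of a vertex. -/
def outdeg (D : Multigraph m q) (v : Fin m) : ℕ :=
  (Finset.univ.filter (fun e => D.src e = v)).card

/-- `D` is 3-regular: every vertex has total degree 3. -/
def ThreeRegular (D : Multigraph m q) : Prop :=
  ∀ v : Fin m, D.indeg v + D.outdeg v = 3

/-- `s` is the unique source (vertex of in-degree 0) of `D`. -/
def UniqueSource (D : Multigraph m q) (s : Fin m) : Prop :=
  D.indeg s = 0 ∧ ∀ v : Fin m, D.indeg v = 0 → v = s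

/-- `t` is the unique sink (vertex of out-degree 0) of `D`. -/
def UniqueSink (D : Multigraph m q) (t : Fin m) : Prop :=
  D.outdeg t = 0 ∧ ∀ v : Fin m, D.outdeg v = 0 → v = t

/-- `μ_D(v)`: the number of directed paths from `s` to `v`, with `μ_D(s) = 1`. -/
noncomputable def mu (D : Multigraph m q) (s v : Fin m) : ℕ :=
  if v = s then 1 else D.pathCount s v

/-- Two vertices are adjacent (disregarding orientation) via an edge in `S`. -/
def Adj (D : Multigraph m q) (S : Set (Fin q)) (a b : Fin m) : Prop :=
  ∃ e ∈ S, (D.src e = a ∧ D.tgt e = b) ∨ (D.src e = b ∧ D.tgt e = a)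

/-- Weak connectivity using only the edges in `S`: any two distinct vertices are joined
by a finite sequence of edges of `S` traversed in either direction. -/
def WeaklyConnectedOn (D : Multigraph m q) (S : Set (Fin q)) : Prop :=
  ∀ a b : Fin m, a ≠ b → Relation.ReflTransGen (D.Adj S) a b

/-- `D` is weakly connected. -/
def WeaklyConnected (D : Multigraph m q) : Prop :=
  D.WeaklyConnectedOn Set.univ

/-- `D` is `ℓ`-edge connected: it has at least two vertices, and deleting any set of at
most `ℓ - 1` edges leaves a weakly connected multigraph. -/
def EdgeConnected (D : Multigraph m q) (ℓ : ℕ) : Prop :=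
  2 ≤ m ∧ ∀ F : Finset (Fin q), F.card ≤ ℓ - 1 → D.WeaklyConnectedOn {e | e ∉ F}

/-- `p` is a directed Hamiltonian path of `D` starting at `u`: a directed path that
visits every vertex exactly once. -/
def IsHamiltonianPath (D : Multigraph m q) (u : Fin m) (p : List (Fin q)) : Prop :=
  (∃ v, D.IsPath u v p) ∧ (u :: p.map D.tgt).Nodup ∧
    ∀ w : Fin m, w ∈ u :: p.map D.tgt

/-- `D` contains a directed Hamiltonian path. -/
def HasHamiltonianPath (D : Multigraph m q) : Prop :=
  ∃ u p, D.IsHamiltonianPath u p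

/-- `D` is simple: no two distinct edges have the same unordered pair of endpoints. -/
def Simple (D : Multigraph m q) : Prop :=
  ∀ e e' : Fin q, e ≠ e' →
    ¬ ((D.src e = D.src e' ∧ D.tgt e = D.tgt e') ∨
       (D.src e = D.tgt e' ∧ D.tgt e = D.src e'))

/-- `D` together with designated edges `H i` (from vertex `i` to vertex `i+1`, 0-based)
is a Hamiltonian-path digraph: the designated edges are pairwise distinct, form the
Hamiltonian path, and every edge goes from a smaller vertex to a larger one.
(Vertices `0, …, m-1` here represent the vertices `1, …, m`.) -/
def IsHamPathDigraph (D : Multigraph m q) (H : Fin (m - 1) → Fin q) : Prop :=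
  Function.Injective H ∧
  (∀ i : Fin (m - 1), (D.src (H i)).val = i.val ∧ (D.tgt (H i)).val = i.val + 1) ∧
  ∀ e : Fin q, (D.src e).val < (D.tgt e).val

end Multigraph

namespace Multigraph

variable {m q : ℕ}

theorem isPath_iff (D : Multigraph m q) (u v : Fin m) (p : List (Fin q)) :
    D.IsPath u v p ↔ (∃ e ∈ p.head?, D.src e = u) ∧ (∃ e ∈ p.getLast?, D.tgt e = v) ∧
      p.IsChain (fun a b => D.tgt a = D.src b) := by
  have h1 : (∃ e rest, p = e :: rest ∧ D.src e = u) ↔ ∃ e ∈ p.head?, D.src e = u := by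
    cases p <;> simp
  have h2 : (∃ e rest, p = rest ++ [e] ∧ D.tgt e = v) ↔ ∃ e ∈ p.getLast?, D.tgt e = v := by
    rcases List.eq_nil_or_concat' p with rfl | ⟨p, f, rfl⟩
    · simp
    · constructor
      · rintro ⟨e, r, h, h'⟩
        exact ⟨e, by simp [h], h'⟩
      · rintro ⟨e, h, h'⟩
        exact ⟨e, p, by simp at h; simp [h], h'⟩
  unfold IsPath
  rw [h1, h2]
  exact Iff.rfl

/-- `p` is a possibly empty directed path from `u` to `v`. -/
def IsWalk (D : Multigraph m q) (u v : Fin m) (p : List (Fin q)) : Prop :=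
  (p = [] ∧ u = v) ∨ D.IsPath u v p

theorem isPath_concat (D : Multigraph m q) {u v : Fin m} {p : List (Fin q)} {e : Fin q} :
    D.IsPath u v (p ++ [e]) ↔ D.tgt e = v ∧ D.IsWalk u (D.src e) p := by
  rw [IsWalk, isPath_iff, isPath_iff, List.isChain_append, List.getLast?_concat]
  cases p with
  | nil => simp; tauto
  | cons f p =>
    have : (f :: p).getLast? = some ((f :: p).getLast (by simp)) :=
      List.getLast?_eq_some_getLast _
    simp [this]
    tauto

theorem isWalk_nil (D : Multigraph m q) {u v : Fin m} : D.IsWalk u v [] ↔ u = v := by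
  simp [IsWalk, isPath_iff]

theorem isWalk_concat (D : Multigraph m q) {u v : Fin m} {p : List (Fin q)} {e : Fin q} :
    D.IsWalk u v (p ++ [e]) ↔ D.tgt e = v ∧ D.IsWalk u (D.src e) p := by
  rw [← isPath_concat]
  simp [IsWalk]

/-- `r` strictly increases along every edge of `D`. -/
def IsRank (D : Multigraph m q) (r : Fin m → ℕ) : Prop :=
  ∀ e, r (D.src e) < r (D.tgt e)

theorem IsRank.add_length_le {D : Multigraph m q} {r : Fin m → ℕ} (hr : D.IsRank r)
    {u v : Fin m} {p : List (Fin q)} (h : D.IsWalk u v p) : r u + p.length ≤ r v := by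
  induction p using List.reverseRecOn generalizing v with
  | nil => simp [D.isWalk_nil.1 h]
  | append_singleton p e ih =>
    obtain ⟨rfl, h'⟩ := D.isWalk_concat.1 h
    have := ih h'
    have := hr e
    simp
    lia

theorem IsRank.acyclic {D : Multigraph m q} {r : Fin m → ℕ} (hr : D.IsRank r) : D.Acyclic := by
  rintro v ⟨p, hp⟩
  have h := hr.add_length_le (Or.inr hp)
  have : p = [] := List.length_eq_zero_iff.1 (by lia)
  subst this
  simp [isPath_iff] at hp

theorem Acyclic.exists_isRank {D : Multigraph m q} (h : D.Acyclic) : ∃ r, D.IsRank r := by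
  classical
  refine ⟨fun v => (Finset.univ.filter fun w => ∃ p, D.IsPath w v p).card, fun e => ?_⟩
  refine Finset.card_lt_card (Finset.ssubset_iff_of_subset ?_ |>.2 ⟨D.src e, ?_, ?_⟩)
  · intro w
    simp only [Finset.mem_filter, Finset.mem_univ, true_and]
    rintro ⟨p, hp⟩
    exact ⟨p ++ [e], D.isPath_concat.2 ⟨rfl, Or.inr hp⟩⟩
  · simp only [Finset.mem_filter, Finset.mem_univ, true_and]
    exact ⟨[] ++ [e], D.isPath_concat.2 ⟨rfl, D.isWalk_nil.2 rfl⟩⟩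
  · simpa using fun p hp => h _ ⟨p, hp⟩

theorem Acyclic.finite_isWalk {D : Multigraph m q} (h : D.Acyclic) (u v : Fin m) :
    Finite {p // D.IsWalk u v p} := by
  obtain ⟨r, hr⟩ := h.exists_isRank
  refine Set.Finite.subset (List.finite_length_le (Fin q) (r v)) fun p hp => ?_
  have := hr.add_length_le hp
  simp only [Set.mem_ofPred_eq]
  lia

theorem Acyclic.mu_eq {D : Multigraph m q} (h : D.Acyclic) (u v : Fin m) :
    D.mu u v = Nat.card {p // D.IsWalk u v p} := by
  unfold mu
  split_ifs with huv
  · subst huv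
    have : ∀ p, D.IsWalk v v p ↔ p = [] := fun p =>
      ⟨fun hp => hp.elim And.left fun hp => (h v ⟨p, hp⟩).elim, fun hp => Or.inl ⟨hp, rfl⟩⟩
    simp [this]
  · have : ∀ p, D.IsWalk u v p ↔ D.IsPath u v p := fun p =>
      ⟨fun hp => hp.elim (fun hp => (huv hp.2.symm).elim) id, Or.inr⟩
    simp [this, pathCount]

/-- Last-edge recursion for the number of paths. -/
theorem Acyclic.mu_eq_add_sum {D : Multigraph m q} (h : D.Acyclic) (u v : Fin m) :
    D.mu u v = (if u = v then 1 else 0) + ∑ e with D.tgt e = v, D.mu u (D.src e) := by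
  have key : Nat.card {p // D.IsWalk u v p ∧ p ≠ []} =
      ∑ e with D.tgt e = v, D.mu u (D.src e) := by
    have := h.finite_isWalk
    rw [Finset.sum_subtype (p := fun e => D.tgt e = v) _ (by simp)]
    simp_rw [h.mu_eq]
    rw [← Nat.card_sigma]
    symm
    refine Nat.card_congr (Equiv.ofBijective (fun x => ⟨x.2.1 ++ [x.1.1],
      D.isWalk_concat.2 ⟨x.1.2, x.2.2⟩, by simp⟩) ⟨?_, ?_⟩)
    · rintro ⟨⟨e, he⟩, p, hp⟩ ⟨⟨f, hf⟩, p', hp'⟩ hh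
      simp only [Subtype.mk.injEq, List.append_singleton_inj] at hh
      obtain ⟨rfl, rfl⟩ := hh
      rfl
    · rintro ⟨p, hp, hne⟩
      obtain rfl | ⟨p, e, rfl⟩ := List.eq_nil_or_concat' p
      · exact (hne rfl).elim
      · obtain ⟨h1, h2⟩ := D.isWalk_concat.1 hp
        exact ⟨⟨⟨e, h1⟩, p, h2⟩, rfl⟩
  rw [← key]
  split_ifs with huv
  · subst huv
    have : IsEmpty {p // D.IsWalk u u p ∧ p ≠ []} :=
      ⟨fun ⟨p, hp, hne⟩ => hp.elim (fun hp => hne hp.1) fun hp => h u ⟨p, hp⟩⟩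
    simp [mu]
  · have : ∀ p, (D.IsWalk u v p ∧ p ≠ []) ↔ D.IsWalk u v p := fun p =>
      ⟨And.left, fun hp => ⟨hp, by rintro rfl; exact huv (D.isWalk_nil.1 hp)⟩⟩
    simp_rw [this, h.mu_eq, zero_add]

/-- First-edge recursion for the number of paths. -/
theorem Acyclic.mu_eq_add_sum' {D : Multigraph m q} (h : D.Acyclic) (u v : Fin m) :
    D.mu u v = (if u = v then 1 else 0) + ∑ e with D.src e = u, D.mu (D.tgt e) v := by
  let S : Matrix (Fin m) (Fin q) ℤ := .of fun i e => if D.src e = i then 1 else 0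
  let T : Matrix (Fin q) (Fin m) ℤ := .of fun e j => if D.tgt e = j then 1 else 0
  let M : Matrix (Fin m) (Fin m) ℤ := .of fun i j => (D.mu i j : ℤ)
  have h1 : M = 1 + M * (S * T) := by
    ext i j
    have := congrArg (Nat.cast (R := ℤ)) (h.mu_eq_add_sum i j)
    rw [← Matrix.mul_assoc, Matrix.add_apply, Matrix.mul_apply]
    simp only [M, S, T, Matrix.mul_apply, Matrix.one_apply, Matrix.of_apply]
    rw [this]
    simp [Finset.sum_filter]
  have h2 : (1 - S * T) * M = 1 := by
    rw [mul_eq_one_comm, mul_sub, mul_one, sub_eq_iff_eq_add]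
    exact h1
  have h3 : M = 1 + S * (T * M) := by
    rw [sub_mul, one_mul, sub_eq_iff_eq_add, Matrix.mul_assoc] at h2
    exact h2
  have h4 := congrFun (congrFun h3 u) v
  rw [Matrix.add_apply, Matrix.mul_apply] at h4
  simp only [M, S, T, Matrix.mul_apply, Matrix.one_apply, Matrix.of_apply] at h4
  zify
  rw [h4]
  simp [Finset.sum_filter]

theorem Acyclic.mu_src_le {D : Multigraph m q} (h : D.Acyclic) (u : Fin m) (e : Fin q) :
    D.mu u (D.src e) ≤ D.mu u (D.tgt e) := by
  rw [h.mu_eq_add_sum u (D.tgt e)]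
  refine le_add_left (Finset.single_le_sum (f := fun e => D.mu u (D.src e)) ?_ ?_)
  · simp
  · simp

theorem Acyclic.mu_tgt_le {D : Multigraph m q} (h : D.Acyclic) (v : Fin m) (e : Fin q) :
    D.mu (D.tgt e) v ≤ D.mu (D.src e) v := by
  rw [h.mu_eq_add_sum' (D.src e) v]
  refine le_add_left (Finset.single_le_sum (f := fun e => D.mu (D.tgt e) v) ?_ ?_)
  · simp
  · simp

/-- Exchange the targets of two edges. -/
def swapTgt (D : Multigraph m q) (e f : Fin q) : Multigraph m q :=
  ⟨D.src, fun g => D.tgt (Equiv.swap e f g)⟩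

section swapTgt

variable {D : Multigraph m q} {e f g : Fin q}

@[simp]
theorem swapTgt_src : (D.swapTgt e f).src g = D.src g := rfl

@[simp]
theorem swapTgt_tgt_left : (D.swapTgt e f).tgt e = D.tgt f := by simp [swapTgt]

@[simp]
theorem swapTgt_tgt_right : (D.swapTgt e f).tgt f = D.tgt e := by simp [swapTgt]

theorem swapTgt_tgt_of_ne (he : g ≠ e) (hf : g ≠ f) : (D.swapTgt e f).tgt g = D.tgt g := by
  simp [swapTgt, Equiv.swap_apply_of_ne_of_ne he hf]

@[simp]
theorem swapTgt_outdeg (v : Fin m) : (D.swapTgt e f).outdeg v = D.outdeg v := rfl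

@[simp]
theorem swapTgt_indeg (v : Fin m) : (D.swapTgt e f).indeg v = D.indeg v :=
  Finset.card_equiv (Equiv.swap e f) (by intro g; simp only [Finset.mem_filter]; simp [swapTgt])

theorem Acyclic.simple_of_injective (h : D.Acyclic)
    (hD : ∀ e f, D.src e = D.src f → D.tgt e = D.tgt f → e = f) : D.Simple := by
  obtain ⟨r, hr⟩ := h.exists_isRank
  rintro e f hne (⟨h1, h2⟩ | ⟨h1, h2⟩)
  · exact hne (hD e f h1 h2)
  · have := hr e
    have := hr f
    rw [h1, h2] at *
    lia

theorem Simple.eq (h : D.Simple) (h1 : D.src e = D.src f) (h2 : D.tgt e = D.tgt f) : e = f := by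
  by_contra hne
  exact h e f hne (Or.inl ⟨h1, h2⟩)

theorem Simple.swapTgt (hD : D.Simple) (h : (D.swapTgt e f).Acyclic) (hsrc : D.src e ≠ D.src f)
    (h1 : ¬ ∃ g, D.src g = D.src e ∧ D.tgt g = D.tgt f)
    (h2 : ¬ ∃ g, D.src g = D.src f ∧ D.tgt g = D.tgt e) : (D.swapTgt e f).Simple := by
  push Not at h1 h2
  refine h.simple_of_injective fun a b hab hab' => ?_
  simp only [swapTgt_src] at hab
  by_cases ha : a = e <;> by_cases ha' : a = f <;> by_cases hb : b = e <;> by_cases hb' : b = f <;>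
    simp_all [swapTgt_tgt_of_ne]
  all_goals grind [Simple.eq]

/-- The exact effect of a target exchange on the number of paths. -/
theorem Acyclic.mu_swapTgt (hD : D.Acyclic) (h : (D.swapTgt e f).Acyclic) (hef : e ≠ f)
    (s t : Fin m) :
    ((D.swapTgt e f).mu s t : ℤ) - D.mu s t =
      ((D.swapTgt e f).mu s (D.src f) - (D.swapTgt e f).mu s (D.src e)) *
        ((D.mu (D.tgt e) t : ℤ) - D.mu (D.tgt f) t) := by
  set D' := D.swapTgt e f with hD'
  have h1 : ∑ v, (D'.mu s v : ℤ) * D.mu v t =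
      D.mu s t + ∑ g, (D'.mu s (D.src g) : ℤ) * D.mu (D'.tgt g) t := by
    have key (v : Fin m) : (D'.mu s v : ℤ) = (if s = v then 1 else 0) +
        ∑ g, if D'.tgt g = v then (D'.mu s (D.src g) : ℤ) else 0 := by
      rw [h.mu_eq_add_sum s v, Finset.sum_filter]
      push_cast
      rfl
    rw [Finset.sum_congr rfl fun v _ => congrArg (· * (D.mu v t : ℤ)) (key v)]
    simp_rw [add_mul, Finset.sum_add_distrib, Finset.sum_mul]
    rw [Finset.sum_comm]
    simp [hD']
  have h2 : ∑ v, (D'.mu s v : ℤ) * D.mu v t =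
      D'.mu s t + ∑ g, (D'.mu s (D.src g) : ℤ) * D.mu (D.tgt g) t := by
    have key (v : Fin m) : (D.mu v t : ℤ) = (if v = t then 1 else 0) +
        ∑ g, if D.src g = v then (D.mu (D.tgt g) t : ℤ) else 0 := by
      rw [hD.mu_eq_add_sum' v t, Finset.sum_filter]
      push_cast
      rfl
    rw [Finset.sum_congr rfl fun v _ => congrArg ((D'.mu s v : ℤ) * ·) (key v)]
    simp_rw [mul_add, Finset.sum_add_distrib, Finset.mul_sum]
    rw [Finset.sum_comm]
    simp
  have h3 : ∑ g, (D'.mu s (D.src g) : ℤ) * (D.mu (D'.tgt g) t - D.mu (D.tgt g) t) =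
      ∑ g ∈ {e, f}, (D'.mu s (D.src g) : ℤ) * (D.mu (D'.tgt g) t - D.mu (D.tgt g) t) := by
    symm
    refine Finset.sum_subset (Finset.subset_univ _) fun g _ hg => ?_
    simp only [Finset.mem_insert, Finset.mem_singleton, not_or] at hg
    rw [hD', swapTgt_tgt_of_ne hg.1 hg.2]
    simp
  rw [Finset.sum_pair hef] at h3
  simp_rw [mul_sub, Finset.sum_sub_distrib] at h3
  rw [hD', swapTgt_tgt_left, swapTgt_tgt_right, ← hD'] at h3
  linarith

end swapTgt

variable {D : Multigraph m q} {s t : Fin m}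

/-- There is an edge from `u` to `v`. -/
def Step (D : Multigraph m q) (u v : Fin m) : Prop :=
  ∃ e, D.src e = u ∧ D.tgt e = v

/-- `D` is a simple 3-regular acyclic digraph with unique source `s` and unique sink `t`. -/
structure IsCubic (D : Multigraph m q) (s t : Fin m) : Prop where
  simple : D.Simple
  regular : D.ThreeRegular
  acyclic : D.Acyclic
  source : D.UniqueSource s
  sink : D.UniqueSink t

theorem IsCubic.swapTgt (h : D.IsCubic s t) {e f : Fin q} (hs : (D.swapTgt e f).Simple)
    (ha : (D.swapTgt e f).Acyclic) : (D.swapTgt e f).IsCubic s t where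
  simple := hs
  regular v := by simpa using h.regular v
  acyclic := ha
  source := by simpa [UniqueSource] using h.source
  sink := by simpa [UniqueSink] using h.sink

theorem exists_src_eq {v : Fin m} (h : D.outdeg v ≠ 0) : ∃ e, D.src e = v := by
  obtain ⟨e, he⟩ := Finset.card_ne_zero.1 h
  exact ⟨e, by simpa using he⟩

theorem exists_tgt_eq {v : Fin m} (h : D.indeg v ≠ 0) : ∃ e, D.tgt e = v := by
  obtain ⟨e, he⟩ := Finset.card_ne_zero.1 h
  exact ⟨e, by simpa using he⟩

theorem card_le_outdeg {v : Fin m} (S : Finset (Fin m)) (h : ∀ w ∈ S, D.Step v w) :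
    S.card ≤ D.outdeg v := by
  classical
  refine (Finset.card_le_card ?_).trans
    (Finset.card_image_le (s := Finset.univ.filter fun e => D.src e = v) (f := D.tgt))
  intro w hw
  obtain ⟨e, h1, h2⟩ := h w hw
  simp only [Finset.mem_image, Finset.mem_filter, Finset.mem_univ, true_and]
  exact ⟨e, h1, h2⟩

/-- The vertices `s :: l` form a directed path that no edge enters from outside. -/
structure IsInitialPath (D : Multigraph m q) (s : Fin m) (l : List (Fin m)) : Prop where
  nodup : (s :: l).Nodup
  chain : (s :: l).IsChain D.Step
  closed : ∀ e, D.tgt e ∈ s :: l → D.src e ∈ s :: l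

theorem Acyclic.exists_isRank_of_closed (h : D.Acyclic) {L : List (Fin m)}
    (hL : ∀ e, D.tgt e ∈ L → D.src e ∈ L) :
    ∃ r, D.IsRank r ∧ ∀ a ∈ L, ∀ b ∉ L, r a < r b := by
  classical
  obtain ⟨r, hr⟩ := h.exists_isRank
  refine ⟨fun v => if v ∈ L then r v else r v + (∑ w, r w + 1), fun e => ?_, fun a ha b hb => ?_⟩
  · have h1 := hr e
    have h2 := hL e
    dsimp only
    split_ifs <;> lia
  · have : r a ≤ ∑ w, r w := Finset.single_le_sum (f := r) (by simp) (Finset.mem_univ a)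
    simp only [ha, hb, if_true, if_false]
    lia

theorem le_of_isChain_concat {k : List (Fin m)} {x a : Fin m} {f : Fin m → ℕ}
    (hf : ∀ e, f (D.src e) ≤ f (D.tgt e)) (h : (k ++ [x]).IsChain D.Step)
    (ha : a ∈ k ++ [x]) : f a ≤ f x := by
  have h' : (k ++ [x]).IsChain (fun u v => f u ≤ f v) := h.imp fun u v ⟨e, h1, h2⟩ => by
    rw [← h1, ← h2]
    exact hf e
  have : IsTrans (Fin m) (fun u v => f u ≤ f v) := ⟨fun _ _ _ => le_trans⟩
  have := List.pairwise_append.1 h'.pairwise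
  rcases List.mem_append.1 ha with ha | ha
  · exact this.2.2 a ha x (by simp)
  · simp at ha
    simp [ha]

theorem exists_step_of_isChain_concat {k : List (Fin m)} {x a : Fin m}
    (h : (k ++ [x]).IsChain D.Step) (ha : a ∈ k) : ∃ w ∈ k ++ [x], D.Step a w := by
  obtain ⟨k₁, k₂, rfl⟩ := List.append_of_mem ha
  cases k₂ with
  | nil =>
    refine ⟨x, by simp, ?_⟩
    have h' : (k₁ ++ [a, x]).IsChain D.Step := by simpa using h
    simpa using h'.right_of_append
  | cons w k₂ =>
    refine ⟨w, by simp, ?_⟩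
    have h' : (k₁ ++ (a :: w :: (k₂ ++ [x]))).IsChain D.Step := by simpa using h
    exact (List.isChain_cons_cons.1 h'.right_of_append).1

/-- Among the vertices outside a closed set, one with the most paths to `t` can be chosen so
that it is entered only from the closed set. -/
theorem Acyclic.exists_max_mu (h : D.Acyclic) (t : Fin m) {L : List (Fin m)}
    (hne : ∃ v, v ∉ L) :
    ∃ y ∉ L, (∀ e, D.tgt e = y → D.src e ∈ L) ∧ ∀ v ∉ L, D.mu v t ≤ D.mu y t := by
  classical
  obtain ⟨r, hr⟩ := h.exists_isRank
  obtain ⟨v₀, hv₀⟩ := hne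
  obtain ⟨z, hz, hz'⟩ := Finset.exists_max_image (Finset.univ.filter (· ∉ L))
    (fun v => D.mu v t) ⟨v₀, by simpa using hv₀⟩
  obtain ⟨y, hy, hy'⟩ := Finset.exists_min_image
    (Finset.univ.filter fun v => v ∉ L ∧ D.mu v t = D.mu z t) r ⟨z, by simpa using hz⟩
  simp only [Finset.mem_filter, Finset.mem_univ, true_and] at hy hy' hz hz'
  refine ⟨y, hy.1, ?_, fun v hv => (hz' v hv).trans_eq hy.2.symm⟩
  rintro e rfl
  by_contra hL
  have h1 := h.mu_tgt_le t e
  have h2 := hy' _ ⟨hL, le_antisymm (hz' _ hL) (hy.2.symm.trans_le h1)⟩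
  have h3 := hr e
  lia

theorem IsCubic.sink_notMem (h : D.IsCubic s t) {L : List (Fin m)}
    (hL : ∀ e, D.tgt e ∈ L → D.src e ∈ L) (hne : ∃ v, v ∉ L) : t ∉ L := by
  classical
  obtain ⟨r, hr⟩ := h.acyclic.exists_isRank
  obtain ⟨v₀, hv₀⟩ := hne
  obtain ⟨z, hz, hz'⟩ := Finset.exists_max_image (Finset.univ.filter (· ∉ L))
    r ⟨v₀, by simpa using hv₀⟩
  simp only [Finset.mem_filter, Finset.mem_univ, true_and] at hz hz'
  by_cases ho : D.outdeg z = 0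
  · rwa [← h.sink.2 z ho]
  · obtain ⟨e, rfl⟩ := exists_src_eq ho
    have h1 := hz' (D.tgt e) fun h => hz (hL e h)
    have h2 := hr e
    lia

theorem IsInitialPath.concat {l : List (Fin m)} (h : D.IsInitialPath s l) {x y : Fin m}
    (hx : x ∈ (s :: l).getLast?) (hxy : D.Step x y) (hy : y ∉ s :: l)
    (hin : ∀ e, D.tgt e = y → D.src e ∈ s :: l) : D.IsInitialPath s (l ++ [y]) where
  nodup := by
    rw [← List.cons_append, List.nodup_append]
    exact ⟨h.nodup, by simp, by rintro a ha b hb rfl; simp at hb; exact hy (hb ▸ ha)⟩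
  chain := by
    rw [← List.cons_append, List.isChain_append]
    refine ⟨h.chain, by simp, ?_⟩
    rintro a ha b hb
    simp at hb
    rw [← Option.mem_unique hx ha, ← hb]
    exact hxy
  closed e he := by
    rw [← List.cons_append] at he ⊢
    rcases List.mem_append.1 he with he | he
    · exact List.mem_append_left _ (h.closed e he)
    · exact List.mem_append_left _ (hin e (by simpa using he))

theorem IsInitialPath.swapTgt {l : List (Fin m)} (h : D.IsInitialPath s l) {e f : Fin q}
    (he : D.tgt e ∉ s :: l) (hf : D.tgt f ∉ s :: l) : (D.swapTgt e f).IsInitialPath s l where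
  nodup := h.nodup
  chain := h.chain.imp_of_mem_imp fun u v hu hv ⟨g, h1, h2⟩ => by
    refine ⟨g, h1, ?_⟩
    rwa [swapTgt_tgt_of_ne]
    · rintro rfl
      exact he (h2 ▸ hv)
    · rintro rfl
      exact hf (h2 ▸ hv)
  closed g hg := by
    by_cases h1 : g = e
    · subst h1
      simp_all
    by_cases h2 : g = f
    · subst h2
      simp_all
    · rw [swapTgt_tgt_of_ne h1 h2] at hg
      exact h.closed g hg

/-- Redirecting an edge `e` into `y` and an edge `f` out of the last vertex of an initial path
appends `y` to that path. -/
theorem IsCubic.exists_concat (h : D.IsCubic s t) {l : List (Fin m)} (hl : D.IsInitialPath s l)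
    {e f : Fin q} (hlast : D.src f ∈ (s :: l).getLast?)
    (he : D.tgt e ∉ s :: l) (hf : D.tgt f ∉ s :: l)
    (hin : ∀ g, D.tgt g = D.tgt e → D.src g ∈ s :: l) (hmu : D.mu (D.tgt f) t ≤ D.mu (D.tgt e) t)
    (h1 : ¬ D.Step (D.src f) (D.tgt e)) (h2 : ¬ D.Step (D.src e) (D.tgt f)) :
    ∃ D' : Multigraph m q, D'.IsCubic s t ∧ D'.IsInitialPath s (l ++ [D.tgt e]) ∧
      D.mu s t ≤ D'.mu s t := by
  obtain ⟨r, hr, hrL⟩ := h.acyclic.exists_isRank_of_closed hl.closed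
  have hfL : D.src f ∈ s :: l := List.mem_of_getLast? hlast
  have heL : D.src e ∈ s :: l := hin e rfl
  have hsrc : D.src e ≠ D.src f := fun h => h2 ⟨f, h.symm, rfl⟩
  have hacy : (D.swapTgt e f).Acyclic := by
    refine IsRank.acyclic (r := r) fun g => ?_
    by_cases hge : g = e
    · subst hge
      simpa using hrL _ heL _ hf
    by_cases hgf : g = f
    · subst hgf
      simpa using hrL _ hfL _ he
    · rw [swapTgt_tgt_of_ne hge hgf]
      exact hr g
  have hl' := hl.swapTgt he hf
  refine ⟨D.swapTgt e f, h.swapTgt (h.simple.swapTgt hacy hsrc h2 h1) hacy,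
    hl'.concat hlast ⟨f, by simp⟩ he ?_, ?_⟩
  · intro g hg
    by_cases hge : g = e
    · subst hge
      exact heL
    by_cases hgf : g = f
    · subst hgf
      exact hfL
    · rw [swapTgt_tgt_of_ne hge hgf] at hg
      exact hin g hg
  · have key := h.acyclic.mu_swapTgt hacy (fun h => hsrc (h ▸ rfl)) s t
    have hle : (D.swapTgt e f).mu s (D.src e) ≤ (D.swapTgt e f).mu s (D.src f) := by
      obtain ⟨k, hk⟩ := List.getLast?_eq_some_iff.1 hlast
      have hch := hl'.chain
      rw [hk] at heL hch
      exact le_of_isChain_concat (hacy.mu_src_le s) hch heL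
    zify at hle hmu ⊢
    nlinarith [mul_nonneg (sub_nonneg.2 hle) (sub_nonneg.2 hmu)]

/-- If `y` is entered only from `s`, then it can be inserted right after `s` in an initial
path by redirecting the edge `e` from `s` to `v` and an edge `f` out of `y`. -/
theorem IsCubic.exists_insert (h : D.IsCubic s t) {v : Fin m} {l : List (Fin m)}
    (hl : D.IsInitialPath s (v :: l)) {e f g : Fin q} (hes : D.src e = s) (hev : D.tgt e = v)
    (hgs : D.src g = s) (hgy : D.tgt g = D.src f) (hy : D.src f ∉ s :: v :: l)
    (hin : ∀ e', D.tgt e' = D.src f → D.src e' = s) (h2 : ¬ D.Step s (D.tgt f)) :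
    ∃ D' : Multigraph m q, D'.IsCubic s t ∧ D'.IsInitialPath s (D.src f :: v :: l) ∧
      D.mu s t ≤ D'.mu s t := by
  have hvL : v ∈ s :: v :: l := by simp
  have hsL : s ∈ s :: v :: l := by simp
  have hz : D.tgt f ∉ s :: v :: l := fun h => hy (hl.closed f h)
  have hys : D.src f ≠ s := fun h => hy (h ▸ hsL)
  have hyv : D.src f ≠ v := fun h => hy (h ▸ hvL)
  have hsv : s ≠ v := by rintro rfl; simpa using hl.nodup
  have hzs : D.tgt f ≠ s := fun h => hz (h ▸ hsL)
  have htgt (e' : Fin q) : D.tgt e' ≠ s := by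
    intro h'
    have := Finset.card_eq_zero.1 h.source.1
    simp only [Finset.filter_eq_empty_iff] at this
    exact this (Finset.mem_univ e') h'
  obtain ⟨r, hr⟩ := h.acyclic.exists_isRank
  have hzy : D.tgt f ≠ D.src f := fun h => by
    have := hr f
    rw [h] at this
    lia
  have hge : g ≠ e := by
    rintro rfl
    exact hyv (hgy.symm.trans hev)
  have hgf : g ≠ f := by
    rintro rfl
    exact hys hgs
  have hef : e ≠ f := by
    rintro rfl
    exact hys hes
  have hcases (e' : Fin q) : e' = e ∨ e' = f ∨ (D.swapTgt e f).tgt e' = D.tgt e' := by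
    by_cases h1 : e' = e
    · exact Or.inl h1
    by_cases h2 : e' = f
    · exact Or.inr (Or.inl h2)
    · exact Or.inr (Or.inr (swapTgt_tgt_of_ne h1 h2))
  have hacy : (D.swapTgt e f).Acyclic := by
    refine IsRank.acyclic
      (r := fun w => if w = s then 0 else if w = D.src f then 1 else r w + 2) fun e' => ?_
    rcases hcases e' with rfl | rfl | he'
    · simp [hes, hzs, hzy]
    · simp [hev, hys, hsv.symm, hyv.symm]
    · have h1 := htgt e'
      have h2 := hin e'
      have h3 := hr e'
      simp only [he', swapTgt_src, h1, if_false]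
      split_ifs <;> lia
  have hin' (e' : Fin q) (he' : (D.swapTgt e f).tgt e' = D.src f) : D.src e' = s := by
    rcases hcases e' with rfl | rfl | h1
    · exact hes
    · simp [hev, hyv.symm] at he'
    · exact hin e' (h1 ▸ he')
  have hsimple : (D.swapTgt e f).Simple := by
    refine h.simple.swapTgt hacy (hes ▸ hys.symm) (hes ▸ h2) ?_
    rintro ⟨g', h3, h4⟩
    exact hy (h3 ▸ hl.closed g' (by rw [h4, hev]; exact hvL))
  have hgy' : (D.swapTgt e f).tgt g = D.src f := by rw [swapTgt_tgt_of_ne hge hgf, hgy]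
  have hchain := List.isChain_cons_cons.1 hl.chain
  refine ⟨D.swapTgt e f, h.swapTgt hsimple hacy, ⟨?_, ?_, ?_⟩, ?_⟩
  · have := hl.nodup
    simp only [List.nodup_cons, List.mem_cons, not_or] at this hy ⊢
    exact ⟨⟨hys.symm, this.1⟩, hy.2, this.2⟩
  · refine .cons_cons ⟨g, hgs, hgy'⟩ (.cons_cons ⟨f, rfl, by simp [hev]⟩ ?_)
    refine hchain.2.imp_of_mem_imp fun a b ha hb ⟨e', h3, h4⟩ => ⟨e', h3, ?_⟩
    rw [swapTgt_tgt_of_ne, h4]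
    · rintro rfl
      exact (List.nodup_cons.1 hl.nodup).1 (by rwa [← hes, h3])
    · rintro rfl
      exact hz (h4 ▸ List.mem_cons_of_mem _ hb)
  · intro e' he'
    have hsub : ∀ w ∈ s :: v :: l, w ∈ s :: D.src f :: v :: l := by
      intro w
      simp only [List.mem_cons]
      tauto
    rcases hcases e' with rfl | rfl | h3
    · exact hes ▸ by simp
    · simp
    · rw [h3] at he'
      by_cases h4 : D.tgt e' = D.src f
      · rw [swapTgt_src, hin e' h4]
        simp
      · refine hsub _ (hl.closed e' ?_)
        simp only [List.mem_cons, h4] at he' ⊢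
        tauto
  · have key := h.acyclic.mu_swapTgt hacy hef s t
    have hfilter : (Finset.univ.filter fun e' => (D.swapTgt e f).tgt e' = D.src f) = {g} := by
      ext e'
      simp only [Finset.mem_filter, Finset.mem_univ, true_and, Finset.mem_singleton]
      refine ⟨fun he' => hsimple.eq ((hin' e' he').trans hgs.symm) (he'.trans hgy'.symm), ?_⟩
      rintro rfl
      exact hgy'
    have hmu : (D.swapTgt e f).mu s (D.src f) = (D.swapTgt e f).mu s (D.src e) := by
      rw [hacy.mu_eq_add_sum, hfilter]
      simp [hys.symm, hgs, hes]
    rw [hmu, sub_self, zero_mul, sub_eq_zero] at key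
    exact_mod_cast key.ge

theorem IsCubic.exists_extend (h : D.IsCubic s t) {l : List (Fin m)} (hl : D.IsInitialPath s l)
    (hne : ∃ v, v ∉ s :: l) :
    ∃ (D' : Multigraph m q) (l' : List (Fin m)), D'.IsCubic s t ∧ D'.IsInitialPath s l' ∧
      l'.length = l.length + 1 ∧ D.mu s t ≤ D'.mu s t := by
  have htL := h.sink_notMem hl.closed hne
  obtain ⟨y, hyL, hin, hmax⟩ := h.acyclic.exists_max_mu t hne
  obtain ⟨k, x, hk⟩ := (List.eq_nil_or_concat' (s :: l)).resolve_left (by simp)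
  have hlast : x ∈ (s :: l).getLast? := by simp [hk]
  by_cases hxy : D.Step x y
  · exact ⟨D, l ++ [y], h, hl.concat hlast hxy hyL hin, by simp, le_rfl⟩
  obtain ⟨r, hr⟩ := h.acyclic.exists_isRank
  have hxL : x ∈ s :: l := by simp [hk]
  have hsL : s ∈ s :: l := by simp
  have hx_out : ∀ f, D.src f = x → D.tgt f ∉ s :: l := by
    intro f hf hfL
    have h1 := hr f
    have hch := hl.chain
    rw [hk] at hfL hch
    have := le_of_isChain_concat (fun e => (hr e).le) hch hfL
    lia
  have hy_in : D.indeg y ≠ 0 := fun h0 => hyL (h.source.2 y h0 ▸ hsL)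
  obtain ⟨f, hf⟩ := exists_src_eq fun h0 => htL (h.sink.2 x h0 ▸ hxL)
  by_cases hgood : ∃ e, D.tgt e = y ∧ ¬ D.Step (D.src e) (D.tgt f)
  · obtain ⟨e, rfl, he⟩ := hgood
    subst hf
    obtain ⟨D', h1, h2, h3⟩ := h.exists_concat hl hlast hyL (hx_out f rfl) hin
      (hmax _ (hx_out f rfl)) hxy he
    exact ⟨D', _, h1, h2, by simp, h3⟩
  push Not at hgood
  have hby : D.tgt f ≠ y := fun h => hxy ⟨f, hf, h⟩
  have hbL := hx_out f hf
  have hnext (e : Fin q) (he : D.tgt e = y) : ∃ w ∈ s :: l, D.Step (D.src e) w := by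
    have h1 := hin e he
    have hch := hl.chain
    rw [hk] at h1 hch ⊢
    rcases List.mem_append.1 h1 with h1 | h1
    · exact exists_step_of_isChain_concat hch h1
    · exact (hxy ⟨e, by simpa using h1, he⟩).elim
  have hin_s (e : Fin q) (he : D.tgt e = y) : D.src e = s := by
    obtain ⟨w, hwL, hw⟩ := hnext e he
    have hwb : w ≠ D.tgt f := fun h => hbL (h ▸ hwL)
    have hwy : w ≠ y := fun h => hyL (h ▸ hwL)
    have hcard := card_le_outdeg (D := D) (v := D.src e) {w, y, D.tgt f} (by
      simp only [Finset.mem_insert, Finset.mem_singleton]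
      rintro _ (rfl | rfl | rfl)
      exacts [hw, ⟨e, rfl, he⟩, hgood e he])
    rw [Finset.card_eq_three.2 ⟨w, y, D.tgt f, hwy, hwb, hby.symm, rfl⟩] at hcard
    have := h.regular (D.src e)
    exact h.source.2 _ (by lia)
  obtain ⟨g, hg⟩ := exists_tgt_eq hy_in
  have hgs := hin_s g hg
  have hindeg : D.indeg y ≤ 1 := by
    refine Finset.card_le_one.2 fun a ha b hb => ?_
    simp only [Finset.mem_filter, Finset.mem_univ, true_and] at ha hb
    exact h.simple.eq ((hin_s a ha).trans (hin_s b hb).symm) (ha.trans hb.symm)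
  have houtdeg : 1 < D.outdeg y := by
    have := h.regular y
    lia
  obtain ⟨f', hf', hf'b⟩ : ∃ f', D.src f' = y ∧ D.tgt f' ≠ D.tgt f := by
    obtain ⟨a, ha, b, hb, hab⟩ := Finset.one_lt_card.1 houtdeg
    simp only [Finset.mem_filter, Finset.mem_univ, true_and] at ha hb
    by_cases h1 : D.tgt a = D.tgt f
    · exact ⟨b, hb, fun h2 => hab (h.simple.eq (ha.trans hb.symm) (h1.trans h2.symm))⟩
    · exact ⟨a, ha, h1⟩
  subst hf'
  cases l with
  | nil =>
    have : x = s := by simpa using hxL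
    exact (hxy ⟨g, hgs.trans this.symm, hg⟩).elim
  | cons v l =>
    obtain ⟨e, hes, hev⟩ := (List.isChain_cons_cons.1 hl.chain).1
    have hvL : v ∈ s :: v :: l := by simp
    have hzL : D.tgt f' ∉ s :: v :: l := fun h => hyL (hl.closed f' h)
    have hzy : D.tgt f' ≠ D.src f' := fun h => by
      have := hr f'
      rw [h] at this
      lia
    have hsz : ¬ D.Step s (D.tgt f') := by
      intro hsz
      have hcard := card_le_outdeg (D := D) (v := s) {v, D.src f', D.tgt f, D.tgt f'} (by
        simp only [Finset.mem_insert, Finset.mem_singleton]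
        rintro _ (rfl | rfl | rfl | rfl)
        exacts [⟨e, hes, hev⟩, ⟨g, hgs, hg⟩, hgs ▸ hgood g hg, hsz])
      have hvy : v ≠ D.src f' := fun h => hyL (h ▸ hvL)
      have hvb : v ≠ D.tgt f := fun h => hbL (h ▸ hvL)
      have hvz : v ≠ D.tgt f' := fun h => hzL (h ▸ hvL)
      rw [Finset.card_insert_of_notMem (by simp [hvy, hvb, hvz]),
        Finset.card_eq_three.2 ⟨_, _, _, hby.symm, hzy.symm, hf'b.symm, rfl⟩] at hcard
      have := h.regular s
      lia
    obtain ⟨D', h1, h2, h3⟩ := h.exists_insert hl hes hev hgs hg hyL hin_s hsz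
    exact ⟨D', _, h1, h2, by simp, h3⟩

theorem IsCubic.exists_spanning (h : D.IsCubic s t) {l : List (Fin m)}
    (hl : D.IsInitialPath s l) :
    ∃ (D' : Multigraph m q) (l' : List (Fin m)), D'.IsCubic s t ∧ D'.IsInitialPath s l' ∧
      (∀ v, v ∈ s :: l') ∧ D.mu s t ≤ D'.mu s t := by
  induction hd : m - l.length generalizing D l with
  | zero =>
    have := hl.nodup.length_le_card
    simp at this
    lia
  | succ d ih =>
    by_cases hne : ∃ v, v ∉ s :: l
    · obtain ⟨D', l', h1, h2, h3, h4⟩ := h.exists_extend hl hne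
      obtain ⟨D'', l'', h5, h6, h7, h8⟩ := ih h1 h2 (by lia)
      exact ⟨D'', l'', h5, h6, h7, h4.trans h8⟩
    · push Not at hne
      exact ⟨D, l, h, hl, hne, le_rfl⟩

theorem exists_isWalk_of_isChain {l : List (Fin m)} (h : (s :: l).IsChain D.Step) :
    ∃ p, p.map D.tgt = l ∧ ∃ v ∈ (s :: l).getLast?, D.IsWalk s v p := by
  induction l using List.reverseRecOn with
  | nil => exact ⟨[], rfl, s, by simp, D.isWalk_nil.2 rfl⟩
  | append_singleton l w ih =>
    rw [← List.cons_append, List.isChain_append] at h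
    obtain ⟨p, hp, v, hv, hw⟩ := ih h.1
    obtain ⟨e, rfl, rfl⟩ := h.2.2 v hv w (by simp)
    refine ⟨p ++ [e], by simp [hp], D.tgt e, ?_, D.isWalk_concat.2 ⟨rfl, hw⟩⟩
    rw [← List.cons_append, List.getLast?_concat]
    rfl

theorem IsInitialPath.hasHamiltonianPath {l : List (Fin m)} (h : D.IsInitialPath s l)
    (hall : ∀ v, v ∈ s :: l) (hl : l ≠ []) : D.HasHamiltonianPath := by
  obtain ⟨p, hp, v, -, hw⟩ := exists_isWalk_of_isChain h.chain
  refine ⟨s, p, ⟨v, hw.resolve_left ?_⟩, hp ▸ h.nodup, hp ▸ hall⟩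
  rintro ⟨rfl, -⟩
  exact hl hp.symm

end Multigraph

/-- Every simple 3-regular acyclic finite directed multigraph on `2n`
vertices with a unique source and unique sink is dominated (in source-to-sink path count)
by a simple one with a directed Hamiltonian path. -/
theorem exists_hamiltonian_dominating_simple (n q : ℕ) (D : Multigraph (2 * n) q)
    (s t : Fin (2 * n)) (hsimple : D.Simple) (hreg : D.ThreeRegular) (hacy : D.Acyclic)
    (hs : D.UniqueSource s) (ht : D.UniqueSink t) :
    ∃ (q' : ℕ) (D' : Multigraph (2 * n) q') (s' t' : Fin (2 * n)),
      D'.Simple ∧ D'.ThreeRegular ∧ D'.Acyclic ∧ D'.UniqueSource s' ∧ D'.UniqueSink t' ∧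
      D'.HasHamiltonianPath ∧ D.mu s t ≤ D'.mu s' t' := by
  have hC : D.IsCubic s t := ⟨hsimple, hreg, hacy, hs, ht⟩
  have hl : D.IsInitialPath s [] := by
    refine ⟨by simp, by simp, fun e he => ?_⟩
    have := Finset.filter_eq_empty_iff.1 (Finset.card_eq_zero.1 hs.1)
    exact (this (Finset.mem_univ e) (by simpa using he)).elim
  obtain ⟨D', l, h, hl, hall, hmu⟩ := hC.exists_spanning hl
  refine ⟨q, D', s, t, h.simple, h.regular, h.acyclic, h.source, h.sink,
    hl.hasHamiltonianPath hall ?_, hmu⟩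
  rintro rfl
  have h1 (v : Fin (2 * n)) : v = s := by simpa using hall v
  have h2 := s.isLt
  have h3 := congrArg Fin.val (h1 ⟨0, by lia⟩)
  have h4 := congrArg Fin.val (h1 ⟨1, by lia⟩)
  simp at h3 h4
  lia
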